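/- Non-degeneracy of the constrained minimum (Proposition 2.2): there exists a constant c₀ > 0 such that for every even function v : ℝ → ℝ that is differentiable with v and v' square-integrable and satisfies ⟨v, η⟩ = 0, the map s ↦ 𝓗(s·v), defined for |s| small, is twice differentiable at s = 0 and its second derivative at s = 0 is at least c₀·‖v‖_{H¹}², where ‖v‖_{H¹}² = ∫_ℝ (v² + v'²). -/

import Mathlib

open MeasureTheory

/-- The ground state `η(x) = (1/2) sech(x/2)`. -/
noncomputable def eta (x : ℝ) : ℝ := (1/2) * (1 / Real.cosh (x/2))

/-- The energy `H(ψ) = (1/4) ∫ (ψ'² − ψ⁴)`. -/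
noncomputable def energy (ψ : ℝ → ℝ) : ℝ := (1/4) * ∫ x : ℝ, ((deriv ψ x)^2 - (ψ x)^4)

/-- Squared `H¹` norm: `‖f‖_{H¹}² = ∫ (f² + f'²)`. -/
noncomputable def H1sq (f : ℝ → ℝ) : ℝ := ∫ x : ℝ, ((f x)^2 + (deriv f x)^2)

/-- The restricted energy on the unit `L²` sphere in the chart around `η`:
`𝓗(u) = H(√(1 − ∫ u²)·η + u)`. -/
noncomputable def calH (u : ℝ → ℝ) : ℝ :=
  energy (fun x => Real.sqrt (1 - ∫ y : ℝ, (u y)^2) * eta x + u x)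

open Filter Topology Set

lemma eta_pos (x : ℝ) : 0 < eta x := by
  unfold eta; have := Real.cosh_pos (x / 2); positivity

lemma four_mul_eta_sq (x : ℝ) : 4 * eta x ^ 2 = 1 - Real.tanh (x / 2) ^ 2 := by
  have h := Real.cosh_sq (x / 2)
  have h0 := (Real.cosh_pos (x / 2)).ne'
  rw [Real.tanh_eq_sinh_div_cosh]
  unfold eta
  field_simp
  linarith

lemma hasDerivAt_tanh_half (x : ℝ) :
    HasDerivAt (fun y => Real.tanh (y / 2)) (2 * eta x ^ 2) x := by
  have h0 := (Real.cosh_pos (x / 2)).ne'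
  have hx : HasDerivAt (fun y : ℝ => y / 2) (1 / 2) x := (hasDerivAt_id x).div_const 2
  have h := hx.sinh.div hx.cosh h0
  have e : (fun y : ℝ => Real.tanh (y / 2)) =
      (fun y => Real.sinh (y / 2)) / (fun y => Real.cosh (y / 2)) := by
    funext y; simp [Real.tanh_eq_sinh_div_cosh]
  rw [e]
  refine h.congr_deriv ?_
  have h1 := Real.cosh_sq (x / 2)
  unfold eta
  field_simp
  linarith

lemma hasDerivAt_eta (x : ℝ) :
    HasDerivAt eta (-(1 / 2) * eta x * Real.tanh (x / 2)) x := by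
  have h0 := (Real.cosh_pos (x / 2)).ne'
  have hx : HasDerivAt (fun y : ℝ => y / 2) (1 / 2) x := (hasDerivAt_id x).div_const 2
  have h := ((hasDerivAt_const x (1 : ℝ)).div hx.cosh h0).const_mul (1 / 2)
  refine h.congr_deriv ?_
  rw [Real.tanh_eq_sinh_div_cosh]
  unfold eta
  field_simp
  ring

lemma differentiable_eta : Differentiable ℝ eta := fun x => (hasDerivAt_eta x).differentiableAt

lemma eta_neg (x : ℝ) : eta (-x) = eta x := by
  unfold eta; rw [neg_div, Real.cosh_neg]

lemma eta_le_half (x : ℝ) : eta x ≤ 1 / 2 := by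
  nlinarith [four_mul_eta_sq x, sq_nonneg (Real.tanh (x / 2)), eta_pos x]

lemma eta_sq_le (x : ℝ) : eta x ^ 2 ≤ (1 + x ^ 2)⁻¹ := by
  have h1 : (x / 2) ^ 2 ≤ Real.sinh (x / 2) ^ 2 := by
    have h := Real.self_le_sinh_iff.2 (abs_nonneg (x / 2))
    have h2 : Real.sinh |x / 2| ^ 2 = Real.sinh (x / 2) ^ 2 := by
      have a := Real.cosh_sq |x / 2|
      have b := Real.cosh_sq (x / 2)
      rw [Real.cosh_abs] at a
      linarith
    rw [← h2, ← sq_abs (x / 2)]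
    exact pow_le_pow_left₀ (abs_nonneg _) h 2
  have h2 := Real.cosh_sq (x / 2)
  have e : eta x ^ 2 = (4 * Real.cosh (x / 2) ^ 2)⁻¹ := by
    unfold eta; field_simp; norm_num
  rw [e]
  apply inv_anti₀ (by positivity)
  nlinarith

lemma integrable_eta_sq : Integrable (fun x => eta x ^ 2) :=
  integrable_inv_one_add_sq.mono'
    (differentiable_eta.continuous.pow 2).aestronglyMeasurable
    (Eventually.of_forall fun x => by
      rw [Real.norm_of_nonneg (sq_nonneg _)]; exact eta_sq_le x)

lemma tendsto_tanh_half_atTop : Tendsto (fun x : ℝ => Real.tanh (x / 2)) atTop (𝓝 1) := by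
  have h : Tendsto (fun x : ℝ => 1 - 2 * (Real.exp x + 1)⁻¹) atTop (𝓝 (1 - 2 * 0)) :=
    ((tendsto_inv_atTop_zero.comp
      (tendsto_atTop_add_const_right _ 1 Real.tendsto_exp_atTop)).const_mul 2).const_sub 1
  simp only [mul_zero, sub_zero] at h
  refine h.congr fun x => ?_
  rw [Real.tanh_eq, Real.exp_neg]
  have e : Real.exp x = Real.exp (x / 2) * Real.exp (x / 2) := by
    rw [← Real.exp_add]; congr 1; ring
  have := Real.exp_pos (x / 2)
  rw [e]
  field_simp
  ring

lemma tendsto_tanh_half_atBot : Tendsto (fun x : ℝ => Real.tanh (x / 2)) atBot (𝓝 (-1)) := by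
  refine (tendsto_tanh_half_atTop.comp tendsto_neg_atBot_atTop).neg.congr fun x => ?_
  simp [neg_div, Real.tanh_neg]

lemma tendsto_eta_atTop : Tendsto eta atTop (𝓝 0) := by
  have h : Tendsto (fun x => eta x ^ 2) atTop (𝓝 0) := by
    have := ((tendsto_tanh_half_atTop.pow 2).const_sub 1).div_const 4
    simp only [one_pow, sub_self, zero_div] at this
    refine this.congr fun x => ?_
    linarith [four_mul_eta_sq x]
  have := h.sqrt
  simp only [Real.sqrt_zero] at this
  exact this.congr fun x => Real.sqrt_sq (eta_pos x).le

lemma integral_eta_sq : ∫ x, eta x ^ 2 = 1 := by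
  have h := integral_of_hasDerivAt_of_tendsto (f := fun x : ℝ => Real.tanh (x / 2) / 2)
    (f' := fun x => eta x ^ 2)
    (fun x => ((hasDerivAt_tanh_half x).div_const 2).congr_deriv (by ring))
    integrable_eta_sq (tendsto_tanh_half_atBot.div_const 2) (tendsto_tanh_half_atTop.div_const 2)
  rw [h]; norm_num

lemma memLp_eta : MemLp eta 2 :=
  (memLp_two_iff_integrable_sq differentiable_eta.continuous.aestronglyMeasurable).2
    integrable_eta_sq

lemma abs_tanh_half_le (x : ℝ) : |Real.tanh (x / 2)| ≤ 1 := (Real.abs_tanh_lt_one _).le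

lemma abs_deriv_eta_le (x : ℝ) : |deriv eta x| ≤ eta x := by
  rw [(hasDerivAt_eta x).deriv, abs_mul, abs_mul, abs_of_pos (eta_pos x)]
  have := abs_tanh_half_le x
  have := eta_pos x
  norm_num
  nlinarith

lemma memLp_deriv_eta : MemLp (deriv eta) 2 :=
  memLp_eta.of_le (measurable_deriv eta).aestronglyMeasurable
    (Eventually.of_forall fun x => by
      rw [Real.norm_of_nonneg (eta_pos x).le]; exact abs_deriv_eta_le x)

/-- The product of two square-integrable functions with a bounded continuous one. -/
lemma integrable_bounded_mul {f g b : ℝ → ℝ} {C : ℝ} (hf : MemLp f 2) (hg : MemLp g 2)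
    (hb : Continuous b) (hC : ∀ x, |b x| ≤ C) : Integrable (fun x => b x * (f x * g x)) :=
  (hf.integrable_mul hg).bdd_mul hb.aestronglyMeasurable (Eventually.of_forall hC)

/-- `v` vanishes at infinity when `v` and its derivative are square-integrable. -/
lemma tendsto_zero_of_memLp {v : ℝ → ℝ} (hd : Differentiable ℝ v) (h0 : MemLp v 2)
    (h1 : MemLp (deriv v) 2) : Tendsto v atTop (𝓝 0) := by
  have h : Tendsto (fun x => v x ^ 2) atTop (𝓝 0) := by
    refine tendsto_zero_of_hasDerivAt_of_integrableOn_Ioi (a := 0)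
      (f' := fun x => 2 * (v x * deriv v x))
      (fun x _ => ((hd x).hasDerivAt.pow 2).congr_deriv (by push_cast; ring))
      ((h0.integrable_mul h1).const_mul 2).integrableOn h0.integrable_sq.integrableOn
  have := h.sqrt
  simp only [Real.sqrt_zero, Real.sqrt_sq_eq_abs] at this
  exact (tendsto_zero_iff_abs_tendsto_zero v).2 this

lemma exists_abs_le_of_even {v : ℝ → ℝ} (he : ∀ x, v (-x) = v x) (hd : Differentiable ℝ v)
    (h0 : MemLp v 2) (h1 : MemLp (deriv v) 2) : ∃ C, ∀ x, |v x| ≤ C := by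
  obtain ⟨R, hR⟩ := eventually_atTop.1
    ((tendsto_zero_of_memLp hd h0 h1).abs.eventually (gt_mem_nhds (by simp : |(0 : ℝ)| < 1)))
  obtain ⟨C, hC⟩ := (isCompact_Icc (a := 0) (b := R)).exists_bound_of_continuousOn
    hd.continuous.continuousOn
  refine ⟨max 1 C, fun x => ?_⟩
  have e : v x = v |x| := by
    rcases abs_choice x with h | h <;> rw [h]
    exact (he x).symm
  rw [e]
  rcases le_total R |x| with h | h
  · exact (hR _ h).le.trans (le_max_left _ _)
  · exact (hC _ ⟨abs_nonneg x, h⟩).trans (le_max_right _ _)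

lemma integral_deriv_eta_mul_deriv {v : ℝ → ℝ} (hd : Differentiable ℝ v) (h0 : MemLp v 2)
    (h1 : MemLp (deriv v) 2) :
    ∫ x, deriv eta x * deriv v x
      = -(1 / 4) * (∫ x, v x * eta x) + 2 * ∫ x, eta x ^ 3 * v x := by
  have i1 : Integrable (fun x => v x * eta x) := h0.integrable_mul memLp_eta
  have i2 : Integrable (fun x => eta x ^ 3 * v x) := by
    refine (integrable_bounded_mul memLp_eta h0 (b := fun x => eta x ^ 2)
      (differentiable_eta.continuous.pow 2) (C := 1) fun x => ?_).congr (Eventually.of_forall fun x => ?_)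
    · rw [abs_of_nonneg (sq_nonneg _)]
      nlinarith [eta_pos x, eta_le_half x]
    · simp only; ring
  have i3 : Integrable (fun x => deriv eta x * deriv v x) := memLp_deriv_eta.integrable_mul h1
  have i4 : Integrable (fun x => deriv eta x * v x) := memLp_deriv_eta.integrable_mul h0
  have e : deriv eta = fun x => -(1 / 2) * eta x * Real.tanh (x / 2) :=
    funext fun x => (hasDerivAt_eta x).deriv
  have hder : ∀ x, HasDerivAt (fun x => deriv eta x * v x)
      (((1 / 4) * (v x * eta x) - 2 * (eta x ^ 3 * v x)) + deriv eta x * deriv v x) x := by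
    intro x
    have h2 : HasDerivAt (deriv eta) ((1 / 4) * eta x - 2 * eta x ^ 3) x := by
      rw [e]
      refine (((hasDerivAt_eta x).const_mul _).mul (hasDerivAt_tanh_half x)).congr_deriv ?_
      have := four_mul_eta_sq x
      have : Real.tanh (x / 2) ^ 2 = 1 - 4 * eta x ^ 2 := by linarith
      linear_combination (1 / 4) * eta x * this
    exact (h2.mul (hd x).hasDerivAt).congr_deriv (by ring)
  have i5 := (i1.const_mul (1 / 4)).sub (i2.const_mul 2)
  have h := integral_eq_zero_of_hasDerivAt_of_integrable hder (i5.add i3) i4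
  rw [integral_add (by exact i5) i3, integral_sub (i1.const_mul _) (i2.const_mul _),
    integral_const_mul, integral_const_mul] at h
  linarith

/-- The pointwise completion of squares behind the coercivity estimate. Here `t` stands for
`tanh (x / 2)`, `d` for `v'` and `g` for `η⁻¹ ∫₀ˣ v η`, whose derivative is `v + t g / 2`. -/
lemma completion_of_squares {t : ℝ} (ht0 : 0 ≤ t) (ht1 : t ≤ 1) (v d g : ℝ) :
    -((207 / 400) * (1 - t ^ 2) * v ^ 2 + (89 / 100 + 207 / 100 * t) * v * d
        + (1 - t ^ 2) / 2 * v * g + (19 / 20 + t) * (d * g + v * (v + t * g / 2))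
        + (3813 / 1000 + 828 / 100 * t) / 16 * (1 - t ^ 2) * g ^ 2
        + (-(309 / 1000) + 3813 / 1000 * t + 414 / 100 * t ^ 2) / 4 * g * (v + t * g / 2)) ≤
      d ^ 2 + (97 / 400 - 3 / 2 * (1 - t ^ 2)) * v ^ 2 := by
  have h1 : 0 ≤ 479 / 10000 + 3154 / 10000 * t - 3549 / 10000 * t ^ 2 := by nlinarith
  have h2 : 0 ≤ 203 / 1000 + 62 / 1000 * t - 187 / 1000 * t ^ 2 := by nlinarith
  have h3 := mul_nonneg h1 (sq_nonneg v)
  have h4 := mul_nonneg h2 (sq_nonneg g)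
  have h5 := sq_nonneg (d + (89 / 100 + 207 / 100 * t) / 2 * v + (19 / 10 + 2 * t) / 4 * g)
  linarith

lemma integrable_coercive_integrand {v : ℝ → ℝ} (h0 : MemLp v 2) (h1 : MemLp (deriv v) 2) :
    Integrable (fun x => deriv v x ^ 2 + (97 / 400 - 6 * eta x ^ 2) * v x ^ 2) := by
  refine h1.integrable_sq.add ?_
  refine (integrable_bounded_mul h0 h0 (b := fun x => 97 / 400 - 6 * eta x ^ 2)
    (continuous_const.sub (continuous_const.mul (differentiable_eta.continuous.pow 2)))
    (C := 2) fun x => ?_).congr (Eventually.of_forall fun x => ?_)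
  · rw [abs_le]
    constructor <;> nlinarith [eta_pos x, eta_le_half x]
  · simp only; ring

/-- Half-line coercivity: no symmetry is needed, the constraint is imposed on `(0, ∞)`. -/
lemma integral_Ioi_coercive_nonneg {v : ℝ → ℝ} (hd : Differentiable ℝ v) (h0 : MemLp v 2)
    (h1 : MemLp (deriv v) 2) (ho : ∫ x in Ioi 0, v x * eta x = 0) :
    0 ≤ ∫ x in Ioi 0, (deriv v x ^ 2 + (97 / 400 - 6 * eta x ^ 2) * v x ^ 2) := by
  have hv := tendsto_zero_of_memLp hd h0 h1
  have hQint := integrable_coercive_integrand h0 h1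
  have hc : Continuous (fun x => v x * eta x) := hd.continuous.mul differentiable_eta.continuous
  set F : ℝ → ℝ := fun x => ∫ y in (0 : ℝ)..x, v y * eta y with hF
  have hF' : ∀ x, HasDerivAt F (v x * eta x) x := fun x => hc.integral_hasStrictDerivAt 0 x
    |>.hasDerivAt
  have hFlim : Tendsto F atTop (𝓝 0) := by
    rw [← ho]
    exact intervalIntegral_tendsto_integral_Ioi 0
      (h0.integrable_mul memLp_eta).integrableOn tendsto_id
  set G : ℝ → ℝ := fun x => F x / eta x with hG
  have hGlim : Tendsto G atTop (𝓝 0) := by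
    have hT : ∀ᶠ x : ℝ in atTop, 0 < Real.tanh (x / 2) :=
      tendsto_tanh_half_atTop.eventually (lt_mem_nhds one_pos)
    refine HasDerivAt.lhopital_zero_atTop (Eventually.of_forall hF')
      (Eventually.of_forall hasDerivAt_eta) ?_ hFlim tendsto_eta_atTop ?_
    · filter_upwards [hT] with x hx
      exact mul_ne_zero (mul_ne_zero (by norm_num) (eta_pos x).ne') hx.ne'
    · have := (hv.const_mul (-2)).div tendsto_tanh_half_atTop one_ne_zero
      simp only [mul_zero, zero_div] at this
      refine this.congr' ?_
      filter_upwards [hT] with x hx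
      have := (eta_pos x).ne'
      simp only [Pi.div_apply]
      field_simp
  have hG' : ∀ x, HasDerivAt G (v x + Real.tanh (x / 2) * G x / 2) x := by
    intro x
    have hx := (eta_pos x).ne'
    refine ((hF' x).div (hasDerivAt_eta x) hx).congr_deriv ?_
    simp only [hG]
    field_simp
    ring
  have hG0 : G 0 = 0 := by simp [hG, hF]
  set T : ℝ → ℝ := fun x => Real.tanh (x / 2) with hTdef
  have hT' : ∀ x, HasDerivAt T ((1 - T x ^ 2) / 2) x := fun x =>
    (hasDerivAt_tanh_half x).congr_deriv (by linarith [four_mul_eta_sq x])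
  set E : ℝ → ℝ := fun x => -((89 / 200 + 207 / 200 * T x) * v x ^ 2
    + (19 / 20 + T x) * (v x * G x)
    + (-(309 / 1000) + 3813 / 1000 * T x + 414 / 100 * T x ^ 2) / 8 * G x ^ 2) with hE
  have hE' : ∀ x, HasDerivAt E (-((207 / 400) * (1 - T x ^ 2) * v x ^ 2
        + (89 / 100 + 207 / 100 * T x) * v x * deriv v x
        + (1 - T x ^ 2) / 2 * v x * G x
        + (19 / 20 + T x) * (deriv v x * G x + v x * (v x + T x * G x / 2))
        + (3813 / 1000 + 828 / 100 * T x) / 16 * (1 - T x ^ 2) * G x ^ 2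
        + (-(309 / 1000) + 3813 / 1000 * T x + 414 / 100 * T x ^ 2) / 4 * G x
          * (v x + T x * G x / 2))) x := by
    intro x
    have hv' := (hd x).hasDerivAt
    refine ((((((hT' x).const_mul (207 / 200)).const_add (89 / 200)).mul (hv'.pow 2)).add
      (((hT' x).const_add (19 / 20)).mul (hv'.mul (hG' x)))).add
      ((((((hT' x).const_mul (3813 / 1000)).const_add (-(309 / 1000))).add
        (((hT' x).pow 2).const_mul (414 / 100))).div_const 8).mul
          ((hG' x).pow 2))).neg.congr_deriv ?_
    simp only [hTdef, Pi.pow_apply, Pi.mul_apply, Pi.add_apply]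
    push_cast
    ring
  have hElim : Tendsto E atTop (𝓝 0) := by
    have hT : Tendsto T atTop (𝓝 1) := tendsto_tanh_half_atTop
    have := ((((hT.const_mul (207 / 200)).const_add (89 / 200)).mul (hv.pow 2)).add
      ((hT.const_add (19 / 20)).mul (hv.mul hGlim))).add
      (((((hT.const_mul (3813 / 1000)).const_add (-(309 / 1000))).add
        ((hT.pow 2).const_mul (414 / 100))).div_const 8).mul (hGlim.pow 2)) |>.neg
    norm_num at this
    refine this.congr fun x => ?_
    simp only [hE]
    ring
  have hE0 : E 0 ≤ 0 := by
    simp only [hE, hG0, hTdef]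
    norm_num
    positivity
  have key : ∀ R : ℝ, 0 ≤ R →
      E R ≤ ∫ x in (0 : ℝ)..R, (deriv v x ^ 2 + (97 / 400 - 6 * eta x ^ 2) * v x ^ 2) := by
    intro R hR
    have := intervalIntegral.sub_le_integral_of_hasDeriv_right_of_le hR
      (fun x _ => (hE' x).continuousAt.continuousWithinAt)
      (fun x _ => (hE' x).hasDerivWithinAt) hQint.integrableOn (fun x hx => by
        have hT0 : 0 ≤ T x := by
          simp only [hTdef, Real.tanh_eq_sinh_div_cosh]
          exact div_nonneg (Real.sinh_nonneg_iff.2 (by linarith [hx.1])) (Real.cosh_pos _).le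
        have e : 6 * eta x ^ 2 = 3 / 2 * (1 - T x ^ 2) := by
          linarith [four_mul_eta_sq x]
        rw [e]
        exact completion_of_squares hT0 (Real.tanh_lt_one _).le (v x) (deriv v x) (G x))
    linarith
  exact le_of_tendsto_of_tendsto hElim
    (intervalIntegral_tendsto_integral_Ioi 0 hQint.integrableOn tendsto_id)
    ((eventually_ge_atTop 0).mono key)

lemma deriv_neg_of_even {v : ℝ → ℝ} (he : ∀ x, v (-x) = v x) (x : ℝ) :
    deriv v (-x) = -deriv v x := by
  have h := deriv_comp_neg v x
  simp only [he] at h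
  linarith

lemma integral_eq_two_mul_of_even {f : ℝ → ℝ} (he : ∀ x, f (-x) = f x) :
    ∫ x, f x = 2 * ∫ x in Ioi 0, f x := by
  rw [← integral_comp_abs]
  congr 1
  funext x
  rcases abs_choice x with h | h <;> rw [h]
  exact (he x).symm

lemma integral_coercive_nonneg {v : ℝ → ℝ} (he : ∀ x, v (-x) = v x) (hd : Differentiable ℝ v)
    (h0 : MemLp v 2) (h1 : MemLp (deriv v) 2) (ho : ∫ x, v x * eta x = 0) :
    0 ≤ ∫ x, (deriv v x ^ 2 + (97 / 400 - 6 * eta x ^ 2) * v x ^ 2) := by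
  rw [integral_eq_two_mul_of_even fun x => by rw [he, eta_neg]] at ho
  rw [integral_eq_two_mul_of_even fun x => by
    rw [he, eta_neg, deriv_neg_of_even he, neg_sq]]
  have := integral_Ioi_coercive_nonneg hd h0 h1 (by linarith)
  linarith

/-- The Hessian of the restricted energy controls the `H¹` norm. -/
lemma hessian_lower_bound {v : ℝ → ℝ} (he : ∀ x, v (-x) = v x) (hd : Differentiable ℝ v)
    (h0 : MemLp v 2) (h1 : MemLp (deriv v) 2) (ho : ∫ x, v x * eta x = 0) :
    1 / 2000 * H1sq v ≤ 1 / 2 * ((∫ x, deriv v x ^ 2) - 6 * (∫ x, eta x ^ 2 * v x ^ 2)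
      + 1 / 4 * ∫ x, v x ^ 2) := by
  have iN := h0.integrable_sq
  have iD := h1.integrable_sq
  have iI : Integrable (fun x => eta x ^ 2 * v x ^ 2) := by
    refine (integrable_bounded_mul h0 h0 (b := fun x => eta x ^ 2)
      (differentiable_eta.continuous.pow 2) (C := 1) fun x => ?_).congr
      (Eventually.of_forall fun x => ?_)
    · rw [abs_of_nonneg (sq_nonneg _)]
      nlinarith [eta_pos x, eta_le_half x]
    · simp only; ring
  have hI : ∫ x, eta x ^ 2 * v x ^ 2 ≤ 1 / 4 * ∫ x, v x ^ 2 := by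
    rw [← integral_const_mul]
    refine integral_mono iI (iN.const_mul _) fun x => ?_
    refine mul_le_mul_of_nonneg_right ?_ (sq_nonneg _)
    nlinarith [eta_pos x, eta_le_half x]
  have hJ := integral_coercive_nonneg he hd h0 h1 ho
  have e : ∫ x, (deriv v x ^ 2 + (97 / 400 - 6 * eta x ^ 2) * v x ^ 2)
      = (∫ x, deriv v x ^ 2) + (97 / 400 * (∫ x, v x ^ 2)
        - 6 * ∫ x, eta x ^ 2 * v x ^ 2) := by
    rw [← integral_const_mul, ← integral_const_mul,
      ← integral_sub' (iN.const_mul _) (iI.const_mul _),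
      ← integral_add' iD ((iN.const_mul _).sub (iI.const_mul _))]
    congr 1
    funext x
    simp only [Pi.add_apply, Pi.sub_apply]
    ring
  rw [e] at hJ
  have hH : H1sq v = (∫ x, v x ^ 2) + ∫ x, deriv v x ^ 2 := integral_add iN iD
  have hN : 0 ≤ ∫ x, v x ^ 2 := integral_nonneg fun x => sq_nonneg _
  rw [hH]
  linarith

/-- The energy along `a η + s v`, expanded in powers of `a` and `s`. -/
lemma energy_expansion {v : ℝ → ℝ} (he : ∀ x, v (-x) = v x) (hd : Differentiable ℝ v)
    (h0 : MemLp v 2) (h1 : MemLp (deriv v) 2) (ho : ∫ x, v x * eta x = 0) (a s : ℝ) :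
    energy (fun x => a * eta x + s * v x) = 1 / 4 * (
      a ^ 2 * (-(1 / 4) + 2 * ∫ x, eta x ^ 4) + s ^ 2 * (∫ x, deriv v x ^ 2)
      + 4 * a * s * (∫ x, eta x ^ 3 * v x)
      - a ^ 4 * (∫ x, eta x ^ 4) - 4 * a ^ 3 * s * (∫ x, eta x ^ 3 * v x)
      - 6 * a ^ 2 * s ^ 2 * (∫ x, eta x ^ 2 * v x ^ 2)
      - 4 * a * s ^ 3 * (∫ x, eta x * v x ^ 3) - s ^ 4 * ∫ x, v x ^ 4) := by
  have hηc := differentiable_eta.continuous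
  have hvc := hd.continuous
  obtain ⟨C, hC⟩ := exists_abs_le_of_even he hd h0 h1
  have hη1 : ∀ x, |eta x| ≤ 1 := fun x => by
    rw [abs_of_pos (eta_pos x)]; linarith [eta_le_half x]
  have hmul : ∀ {p q : ℝ → ℝ} {A B : ℝ}, (∀ x, |p x| ≤ A) → (∀ x, |q x| ≤ B) →
      ∀ x, |p x * q x| ≤ A * B := fun hp hq x => by
    rw [abs_mul]
    exact mul_le_mul (hp x) (hq x) (abs_nonneg _) ((abs_nonneg _).trans (hp x))
  have i40 : Integrable (fun x => eta x ^ 4) :=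
    (integrable_bounded_mul memLp_eta memLp_eta (hηc.mul hηc) (hmul hη1 hη1)).congr
      (Eventually.of_forall fun x => by simp only [Pi.mul_apply]; ring)
  have i31 : Integrable (fun x => eta x ^ 3 * v x) :=
    (integrable_bounded_mul memLp_eta h0 (hηc.mul hηc) (hmul hη1 hη1)).congr
      (Eventually.of_forall fun x => by simp only [Pi.mul_apply]; ring)
  have i22 : Integrable (fun x => eta x ^ 2 * v x ^ 2) :=
    (integrable_bounded_mul h0 h0 (hηc.mul hηc) (hmul hη1 hη1)).congr
      (Eventually.of_forall fun x => by simp only [Pi.mul_apply]; ring)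
  have i13 : Integrable (fun x => eta x * v x ^ 3) :=
    (integrable_bounded_mul h0 h0 (hηc.mul hvc) (hmul hη1 hC)).congr
      (Eventually.of_forall fun x => by simp only [Pi.mul_apply]; ring)
  have i04 : Integrable (fun x => v x ^ 4) :=
    (integrable_bounded_mul h0 h0 (hvc.mul hvc) (hmul hC hC)).congr
      (Eventually.of_forall fun x => by simp only [Pi.mul_apply]; ring)
  have iK : Integrable (fun x => deriv eta x * deriv eta x) :=
    memLp_deriv_eta.integrable_mul memLp_deriv_eta
  have iM : Integrable (fun x => deriv eta x * deriv v x) := memLp_deriv_eta.integrable_mul h1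
  have iD := h1.integrable_sq
  have hK : ∫ x, deriv eta x * deriv eta x = -(1 / 4) + 2 * ∫ x, eta x ^ 4 := by
    rw [integral_deriv_eta_mul_deriv differentiable_eta memLp_eta memLp_deriv_eta]
    have e1 : ∫ x, eta x * eta x = 1 := by
      rw [← integral_eta_sq]; congr 1; funext x; ring
    have e2 : ∫ x, eta x ^ 3 * eta x = ∫ x, eta x ^ 4 := by
      congr 1
    rw [e1, e2, mul_one]
  have hM : ∫ x, deriv eta x * deriv v x = 2 * ∫ x, eta x ^ 3 * v x := by
    rw [integral_deriv_eta_mul_deriv hd h0 h1, ho]; ring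
  have hderiv : ∀ x, deriv (fun x => a * eta x + s * v x) x = a * deriv eta x + s * deriv v x :=
    fun x => (((differentiable_eta x).hasDerivAt.const_mul a).add
      ((hd x).hasDerivAt.const_mul s)).deriv
  unfold energy
  simp only [hderiv]
  have hsplit : ∫ x, ((a * deriv eta x + s * deriv v x) ^ 2 - (a * eta x + s * v x) ^ 4)
      = a ^ 2 * (∫ x, deriv eta x * deriv eta x) + s ^ 2 * (∫ x, deriv v x ^ 2)
      + 2 * a * s * (∫ x, deriv eta x * deriv v x)
      - a ^ 4 * (∫ x, eta x ^ 4) - 4 * a ^ 3 * s * (∫ x, eta x ^ 3 * v x)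
      - 6 * a ^ 2 * s ^ 2 * (∫ x, eta x ^ 2 * v x ^ 2)
      - 4 * a * s ^ 3 * (∫ x, eta x * v x ^ 3) - s ^ 4 * ∫ x, v x ^ 4 := by
    have j1 := (iK.const_mul (a ^ 2)).add (iD.const_mul (s ^ 2))
    have j2 := j1.add (iM.const_mul (2 * a * s))
    have j3 := j2.sub (i40.const_mul (a ^ 4))
    have j4 := j3.sub (i31.const_mul (4 * a ^ 3 * s))
    have j5 := j4.sub (i22.const_mul (6 * a ^ 2 * s ^ 2))
    have j6 := j5.sub (i13.const_mul (4 * a * s ^ 3))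
    simp only [← integral_const_mul]
    rw [← integral_add' (iK.const_mul (a ^ 2)) (iD.const_mul (s ^ 2)),
      ← integral_add' j1 (iM.const_mul (2 * a * s)),
      ← integral_sub' j2 (i40.const_mul (a ^ 4)),
      ← integral_sub' j3 (i31.const_mul (4 * a ^ 3 * s)),
      ← integral_sub' j4 (i22.const_mul (6 * a ^ 2 * s ^ 2)),
      ← integral_sub' j5 (i13.const_mul (4 * a * s ^ 3)),
      ← integral_sub' j6 (i04.const_mul (s ^ 4))]
    congr 1
    funext x
    simp only [Pi.add_apply, Pi.sub_apply]
    ring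
  rw [hsplit, hK, hM]
  ring

/-- Differentiability and second derivative at `0` of a function that, near `0`, is a quartic
even polynomial plus `√(1 - N s²)` times a cubic monomial. -/
lemma second_deriv_at_zero {f : ℝ → ℝ} {c₀ c₂ c₄ k N : ℝ}
    (hf : ∀ᶠ s in 𝓝 (0 : ℝ), f s = c₀ + c₂ * s ^ 2 + c₄ * s ^ 4
      + k * (s ^ 3 * √(1 - N * s ^ 2))) :
    DifferentiableAt ℝ f 0 ∧ DifferentiableAt ℝ (deriv f) 0 ∧ deriv (deriv f) 0 = 2 * c₂ := by
  have hpos : ∀ᶠ s in 𝓝 (0 : ℝ), 0 < 1 - N * s ^ 2 :=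
    (continuous_const.sub (continuous_const.mul (continuous_id.pow 2))).continuousAt.eventually
      (lt_mem_nhds (by simp))
  have hsq : ∀ s : ℝ, 0 < 1 - N * s ^ 2 →
      HasDerivAt (fun s => √(1 - N * s ^ 2)) (-(N * s) / √(1 - N * s ^ 2)) s := fun s hs =>
    ((((hasDerivAt_pow 2 s).const_mul N).const_sub 1).sqrt hs.ne').congr_deriv (by
      have := (Real.sqrt_pos.2 hs).ne'
      field_simp
      push_cast
      ring)
  set f₁ : ℝ → ℝ := fun s => c₂ * (2 * s) + c₄ * (4 * s ^ 3)
      + k * (3 * s ^ 2 * √(1 - N * s ^ 2) + s ^ 3 * (-(N * s) / √(1 - N * s ^ 2))) with hf₁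
  have hd1 : ∀ᶠ s in 𝓝 (0 : ℝ), HasDerivAt f (f₁ s) s := by
    filter_upwards [hf.eventually_nhds, hpos] with s hs hp
    refine HasDerivAt.congr_of_eventuallyEq ?_ hs
    refine (((((hasDerivAt_pow 2 s).const_mul c₂).const_add c₀).add
      ((hasDerivAt_pow 4 s).const_mul c₄)).add
      (((hasDerivAt_pow 3 s).mul (hsq s hp)).const_mul k)).congr_deriv ?_
    simp only [hf₁]
    push_cast
    ring
  have hd2 : HasDerivAt f₁ (2 * c₂) 0 := by
    have hs0 := hsq 0 (by simp)
    have hn : √(1 - N * (0 : ℝ) ^ 2) ≠ 0 := by simp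
    refine (((((hasDerivAt_id (0 : ℝ)).const_mul 2).const_mul c₂).add
      (((hasDerivAt_pow 3 (0 : ℝ)).const_mul 4).const_mul c₄)).add
      (((((hasDerivAt_pow 2 (0 : ℝ)).const_mul 3).mul hs0).add
        ((hasDerivAt_pow 3 (0 : ℝ)).mul
          ((((hasDerivAt_id (0 : ℝ)).const_mul N).neg).div hs0 hn))).const_mul k)).congr_deriv ?_
    simp
    ring
  have heq : deriv f =ᶠ[𝓝 0] f₁ := hd1.mono fun s hs => hs.deriv
  have hd3 := hd2.congr_of_eventuallyEq heq
  exact ⟨hd1.self_of_nhds.differentiableAt, hd3.differentiableAt, hd3.deriv⟩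

/-- non-degeneracy of the constrained minimum (Proposition 2.2): there is `c₀ > 0`
such that for every even `H¹` function `v` orthogonal to `η`, the map `s ↦ 𝓗(s·v)` is twice
differentiable at `s = 0` with second derivative at least `c₀‖v‖_{H¹}²`. -/
theorem calH_nondegenerate_minimum :
    ∃ c₀ : ℝ, 0 < c₀ ∧
      ∀ v : ℝ → ℝ, (∀ x, v (-x) = v x) → Differentiable ℝ v →
        Integrable (fun x => (v x)^2) → Integrable (fun x => (deriv v x)^2) →
        (∫ x : ℝ, v x * eta x) = 0 →
        DifferentiableAt ℝ (fun s : ℝ => calH (fun x => s * v x)) 0 ∧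
        DifferentiableAt ℝ (deriv (fun s : ℝ => calH (fun x => s * v x))) 0 ∧
        c₀ * H1sq v ≤ deriv (deriv (fun s : ℝ => calH (fun x => s * v x))) 0 := by
  refine ⟨1 / 2000, by norm_num, fun v he hd hN hD ho => ?_⟩
  have h0 : MemLp v 2 :=
    (memLp_two_iff_integrable_sq hd.continuous.aestronglyMeasurable).2 hN
  have h1 : MemLp (deriv v) 2 :=
    (memLp_two_iff_integrable_sq (measurable_deriv v).aestronglyMeasurable).2 hD
  set N := ∫ x, v x ^ 2 with hNdef
  set D := ∫ x, deriv v x ^ 2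
  set I₄₀ := ∫ x, eta x ^ 4
  set I₃₁ := ∫ x, eta x ^ 3 * v x
  set I₂₂ := ∫ x, eta x ^ 2 * v x ^ 2
  set I₁₃ := ∫ x, eta x * v x ^ 3
  set I₀₄ := ∫ x, v x ^ 4
  have hpos : ∀ᶠ s in 𝓝 (0 : ℝ), 0 < 1 - N * s ^ 2 :=
    (continuous_const.sub (continuous_const.mul (continuous_id.pow 2))).continuousAt.eventually
      (lt_mem_nhds (by simp))
  have hf : ∀ᶠ s in 𝓝 (0 : ℝ), calH (fun x => s * v x) =
      (1 / 4 * (I₄₀ - 1 / 4)) + (1 / 4 * (D - 6 * I₂₂ + 1 / 4 * N)) * s ^ 2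
      + (1 / 4 * (6 * N * I₂₂ - N ^ 2 * I₄₀ - I₀₄)) * s ^ 4
      + (N * I₃₁ - I₁₃) * (s ^ 3 * √(1 - N * s ^ 2)) := by
    filter_upwards [hpos] with s hs
    have e : ∫ x, (s * v x) ^ 2 = N * s ^ 2 := by
      simp only [mul_pow, integral_const_mul, ← hNdef]
      ring
    unfold calH
    rw [e, energy_expansion he hd h0 h1 ho]
    have hsq := Real.sq_sqrt hs.le
    set a := √(1 - N * s ^ 2)
    have h3 : a ^ 3 = (1 - N * s ^ 2) * a := by rw [← hsq]; ring
    have h4 : a ^ 4 = (1 - N * s ^ 2) ^ 2 := by rw [← hsq]; ring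
    rw [h3, h4, hsq]
    ring
  obtain ⟨hd1, hd2, hd3⟩ := second_deriv_at_zero hf
  refine ⟨hd1, hd2, ?_⟩
  rw [hd3]
  have := hessian_lower_bound he hd h0 h1 ho
  linarith
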